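/- Let u : ℝⁿ → ℝⁿ and v : ℝⁿ → ℝᵏ be C¹, and let a : ℝⁿ → Matrix k k ℝ satisfy a(x)ᵀ = -a(x) for all x. If the verticality condition (D v(x))(u(x)) + (1/2)(div u(x)) v(x) = a(x) v(x) holds for all x ∈ ℝⁿ, then div(‖v‖² u) = 0, i.e., ⟨∇(‖v‖²)(x), u(x)⟩ + ‖v(x)‖² · div u(x) = 0 for all x; in other words, u is divergence-free with respect to the density ‖v‖². -/

import Mathlib

open Matrix

noncomputable section

/-- The divergence of a vector field on `ℝⁿ`: the trace of its Fréchet derivative. -/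
def sdiv {n : ℕ} (w : EuclideanSpace ℝ (Fin n) → EuclideanSpace ℝ (Fin n))
    (x : EuclideanSpace ℝ (Fin n)) : ℝ :=
  LinearMap.trace ℝ (EuclideanSpace ℝ (Fin n)) (fderiv ℝ w x).toLinearMap

/-- A skew-symmetric matrix has vanishing quadratic form. -/
lemma inner_toEuclideanLin_self_eq_zero {k : ℕ} {A : Matrix (Fin k) (Fin k) ℝ} (hA : Aᵀ = -A)
    (w : EuclideanSpace ℝ (Fin k)) : inner ℝ w (Matrix.toEuclideanLin A w) = 0 := by
  have h : inner ℝ w (Matrix.toEuclideanLin A w)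
      = -inner ℝ w (Matrix.toEuclideanLin A w) := by
    conv_lhs => rw [← LinearMap.adjoint_inner_left, ← Matrix.toEuclideanLin_conjTranspose_eq_adjoint,
      Matrix.conjTranspose_eq_transpose_of_trivial, hA, map_neg, LinearMap.neg_apply,
      inner_neg_left, real_inner_comm]
  linarith

/-- If the pair `(u, a)` (a vector field and a skew-symmetric matrix
field) acts vertically on the vector half-density `v`, i.e.
`(D v) u + (1/2)(div u) v = a v`, then `u` is divergence free with respect to the
density `‖v‖²`: `⟨∇(‖v‖²), u⟩ + ‖v‖² · div u = 0`. -/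
theorem vertical_implies_divergence_free {n k : ℕ}
    (u : EuclideanSpace ℝ (Fin n) → EuclideanSpace ℝ (Fin n)) (hu : ContDiff ℝ 1 u)
    (v : EuclideanSpace ℝ (Fin n) → EuclideanSpace ℝ (Fin k)) (hv : ContDiff ℝ 1 v)
    (a : EuclideanSpace ℝ (Fin n) → Matrix (Fin k) (Fin k) ℝ)
    (haskew : ∀ x, (a x)ᵀ = -a x)
    (hvert : ∀ x, fderiv ℝ v x (u x) + (((1 : ℝ) / 2) * sdiv u x) • v x
      = Matrix.toEuclideanLin (a x) (v x)) :
    ∀ x, @inner ℝ _ _ (gradient (fun y => ‖v y‖ ^ 2) x) (u x)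
      + ‖v x‖ ^ 2 * sdiv u x = 0 := by
  intro x
  have hd : DifferentiableAt ℝ v x := hv.differentiable one_ne_zero x
  have hgrad : inner ℝ (gradient (fun y => ‖v y‖ ^ 2) x) (u x)
      = 2 * inner ℝ (v x) (fderiv ℝ v x (u x)) := by
    rw [gradient, InnerProductSpace.toDual_symm_apply, hd.hasFDerivAt.norm_sq.fderiv]
    simp
  have hinner := congrArg (inner ℝ (v x)) (hvert x)
  rw [inner_toEuclideanLin_self_eq_zero (haskew x), inner_add_right, real_inner_smul_right,
    real_inner_self_eq_norm_sq] at hinner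
  rw [hgrad]
  linarith

end
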